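/- Along any B₀ T²-symmetric Einstein flow, at every time τ (where H ≠ 0) one has | e^{−3τ} H^{−1/2} Ω | ≲ e^{−2τ} |H|^{−1/2} E Y_τ. -/

import Mathlib

noncomputable section

open Real MeasureTheory intervalIntegral

/-- The θ-mean of a function on the circle of circumference 1 (total measure 1). -/
def circleMean (f : ℝ → ℝ) : ℝ := ∫ θ in (0:ℝ)..1, f θ

/-- The smooth, θ-periodic fields `V, Q, ρ, l` of a T²-symmetric spacetime in areal
coordinates; first argument is `τ`, second is `θ`. -/
structure T2Flow where
  V : ℝ → ℝ → ℝ
  Q : ℝ → ℝ → ℝ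
  ρ : ℝ → ℝ → ℝ
  l : ℝ → ℝ → ℝ
  smooth_V : ContDiff ℝ (⊤ : ℕ∞) (Function.uncurry V)
  smooth_Q : ContDiff ℝ (⊤ : ℕ∞) (Function.uncurry Q)
  smooth_ρ : ContDiff ℝ (⊤ : ℕ∞) (Function.uncurry ρ)
  smooth_l : ContDiff ℝ (⊤ : ℕ∞) (Function.uncurry l)
  periodic_V : ∀ τ, Function.Periodic (V τ) 1
  periodic_Q : ∀ τ, Function.Periodic (Q τ) 1
  periodic_ρ : ∀ τ, Function.Periodic (ρ τ) 1
  periodic_l : ∀ τ, Function.Periodic (l τ) 1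

namespace T2Flow

/-- `V_τ`. -/
def Vτ (F : T2Flow) (τ θ : ℝ) : ℝ := deriv (fun s => F.V s θ) τ
/-- `V_θ`. -/
def Vθ (F : T2Flow) (τ θ : ℝ) : ℝ := deriv (fun x => F.V τ x) θ
/-- `Q_τ`. -/
def Qτ (F : T2Flow) (τ θ : ℝ) : ℝ := deriv (fun s => F.Q s θ) τ
/-- `Q_θ`. -/
def Qθ (F : T2Flow) (τ θ : ℝ) : ℝ := deriv (fun x => F.Q τ x) θ
/-- `ρ_τ`. -/
def ρτ (F : T2Flow) (τ θ : ℝ) : ℝ := deriv (fun s => F.ρ s θ) τ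
/-- `l_τ`. -/
def lτ (F : T2Flow) (τ θ : ℝ) : ℝ := deriv (fun s => F.l s θ) τ
/-- `l_θ`. -/
def lθ (F : T2Flow) (τ θ : ℝ) : ℝ := deriv (fun x => F.l τ x) θ

/-- The energy density
`J = (1/2)[V_τ² + e^{2(τ−ρ)}V_θ² + e^{2(V−τ)}(Q_τ² + e^{2(τ−ρ)}Q_θ²)]`. -/
def J (F : T2Flow) (τ θ : ℝ) : ℝ :=
  (1/2) * (F.Vτ τ θ ^ 2 + exp (2*(τ - F.ρ τ θ)) * F.Vθ τ θ ^ 2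
    + exp (2*(F.V τ θ - τ)) * (F.Qτ τ θ ^ 2 + exp (2*(τ - F.ρ τ θ)) * F.Qθ τ θ ^ 2))

/-- The T²-symmetric vacuum Einstein evolution equations together with the
momentum constraint. -/
def IsEinsteinFlow (F : T2Flow) : Prop :=
  (∀ τ θ : ℝ, deriv (fun s => exp (F.ρ s θ) * F.Vτ s θ) τ
      = deriv (fun x => exp (2*τ - F.ρ τ x) * F.Vθ τ x) θ
        + exp (2*(F.V τ θ - τ) + F.ρ τ θ)
          * (F.Qτ τ θ ^ 2 - exp (2*(τ - F.ρ τ θ)) * F.Qθ τ θ ^ 2)) ∧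
  (∀ τ θ : ℝ, deriv (fun s => exp (F.ρ s θ + 2*(F.V s θ - s)) * F.Qτ s θ) τ
      = deriv (fun x => exp (-F.ρ τ x + 2*F.V τ x) * F.Qθ τ x) θ) ∧
  (∀ τ θ : ℝ, F.lτ τ θ + F.ρτ τ θ + 2 = F.J τ θ) ∧
  (∀ τ θ : ℝ, F.ρτ τ θ = exp (F.l τ θ)) ∧
  (∀ τ θ : ℝ, F.lθ τ θ = F.Vθ τ θ * F.Vτ τ θ
      + exp (2*(F.V τ θ - τ)) * F.Qθ τ θ * F.Qτ τ θ)

/-- The conserved quantity `A = ∫ e^ρ (V_τ − e^{2(V−τ)} Q_τ Q) dθ`. -/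
def A (F : T2Flow) (τ : ℝ) : ℝ :=
  ∫ θ in (0:ℝ)..1,
    exp (F.ρ τ θ) * (F.Vτ τ θ - exp (2*(F.V τ θ - τ)) * F.Qτ τ θ * F.Q τ θ)

/-- The conserved quantity `B = ∫ e^{ρ+2(V−τ)} Q_τ dθ`. -/
def B (F : T2Flow) (τ : ℝ) : ℝ :=
  ∫ θ in (0:ℝ)..1, exp (F.ρ τ θ + 2*(F.V τ θ - τ)) * F.Qτ τ θ

/-- The energy `E = ∫ e^{ρ−2τ} J dθ`. -/
def E (F : T2Flow) (τ : ℝ) : ℝ := ∫ θ in (0:ℝ)..1, exp (F.ρ τ θ - 2*τ) * F.J τ θ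

/-- The `S¹`-volume `Π = ⟨e^ρ⟩`. -/
def Pi (F : T2Flow) (τ : ℝ) : ℝ := ∫ θ in (0:ℝ)..1, exp (F.ρ τ θ)

/-- The correction `Λ = (1/2) e^{−2τ} ∫ V_τ (V − ⟨V⟩ − 1) e^ρ dθ`. -/
def Λ (F : T2Flow) (τ : ℝ) : ℝ :=
  (1/2) * exp (-2*τ) *
    ∫ θ in (0:ℝ)..1, F.Vτ τ θ * (F.V τ θ - circleMean (F.V τ) - 1) * exp (F.ρ τ θ)

/-- The corrected, normalized energy `H = Π (E + Λ)`. -/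
def H (F : T2Flow) (τ : ℝ) : ℝ := F.Pi τ * (F.E τ + F.Λ τ)

/-- The twist potential `Y = ⟨e^{l+ρ+2τ}⟩`. -/
def Y (F : T2Flow) (τ : ℝ) : ℝ := ∫ θ in (0:ℝ)..1, exp (F.l τ θ + F.ρ τ θ + 2*τ)

/-- The error term `Ω = ⟨e^{l+ρ+2τ} J⟩ − e^{2τ} E Y Π⁻¹`. -/
def Ω (F : T2Flow) (τ : ℝ) : ℝ :=
  (∫ θ in (0:ℝ)..1, exp (F.l τ θ + F.ρ τ θ + 2*τ) * F.J τ θ)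
    - exp (2*τ) * F.E τ * F.Y τ / F.Pi τ

end T2Flow

theorem continuous_section {f : ℝ → ℝ → ℝ}
    (hf : Continuous (Function.uncurry f)) (x : ℝ) : Continuous (f x) :=
  hf.comp (Continuous.prodMk_right x)

/-- Differentiation under the integral sign over a compact interval, for a jointly continuous
derivative. -/
theorem hasDerivAt_intervalIntegral_of_continuous {f f' : ℝ → ℝ → ℝ} {a b : ℝ}
    (hf : Continuous (Function.uncurry f)) (hf' : Continuous (Function.uncurry f'))
    (hd : ∀ x t, HasDerivAt (fun s => f s t) (f' x t) x) (x₀ : ℝ) :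
    HasDerivAt (fun x => ∫ t in a..b, f x t) (∫ t in a..b, f' x₀ t) x₀ := by
  have hK : IsCompact (Metric.closedBall x₀ 1 ×ˢ Set.uIcc a b) :=
    (isCompact_closedBall x₀ 1).prod isCompact_uIcc
  obtain ⟨C, hC⟩ := hK.exists_bound_of_continuousOn hf'.continuousOn
  refine (hasDerivAt_integral_of_dominated_loc_of_deriv_le (bound := fun _ => C)
    (Metric.closedBall_mem_nhds x₀ one_pos)
    (Filter.Eventually.of_forall fun x =>
      (continuous_section hf x).aestronglyMeasurable)
    ((continuous_section hf x₀).intervalIntegrable _ _)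
    (continuous_section hf' x₀).aestronglyMeasurable
    (Filter.Eventually.of_forall fun t ht x hx => ?_)
    intervalIntegrable_const
    (Filter.Eventually.of_forall fun t _ x _ => hd x t)).2
  exact hC (x, t) ⟨hx, Set.uIoc_subset_uIcc ht⟩

/-- The oscillation of a function is bounded by the integral of any bound for its derivative. -/
theorem abs_sub_le_integral_of_abs_deriv_le {f f' g : ℝ → ℝ} {a b : ℝ}
    (hd : ∀ x, HasDerivAt f (f' x) x) (hf' : Continuous f') (hg : Continuous g)
    (hle : ∀ x, |f' x| ≤ g x) {x y : ℝ} (hx : x ∈ Set.Icc a b) (hy : y ∈ Set.Icc a b) :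
    |f x - f y| ≤ ∫ t in a..b, g t := by
  wlog hxy : y ≤ x generalizing x y
  · rw [abs_sub_comm]
    exact this hy hx (le_of_not_ge hxy)
  rw [← integral_eq_sub_of_hasDerivAt (fun t _ => hd t) (hf'.intervalIntegrable y x)]
  calc |∫ t in y..x, f' t| ≤ ∫ t in y..x, |f' t| := abs_integral_le_integral_abs hxy
    _ ≤ ∫ t in y..x, g t := integral_mono_on hxy (hf'.abs.intervalIntegrable _ _)
        (hg.intervalIntegrable _ _) fun t _ => hle t
    _ ≤ ∫ t in a..b, g t := integral_mono_interval hy.1 hxy hx.2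
        (Filter.Eventually.of_forall fun t => (abs_nonneg _).trans (hle t))
        (hg.intervalIntegrable _ _)

/-- A weighted covariance bound: if `f` oscillates by at most `K` and `j ≥ 0`, the covariance of
`f` and `j` with respect to the weight `p` is at most `K` times the weighted integral of `j`. -/
theorem abs_weighted_covariance_le {p f j : ℝ → ℝ} {a b K : ℝ} (hab : a < b)
    (hp : Continuous p) (hf : Continuous f) (hj : Continuous j)
    (hp0 : ∀ x, 0 < p x) (hj0 : ∀ x, 0 ≤ j x)
    (hosc : ∀ x ∈ Set.Icc a b, ∀ y ∈ Set.Icc a b, |f x - f y| ≤ K) :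
    |(∫ x in a..b, f x * p x * j x)
        - (∫ x in a..b, p x * j x) * (∫ x in a..b, f x * p x) / ∫ x in a..b, p x|
      ≤ K * ∫ x in a..b, p x * j x := by
  have hP : 0 < ∫ x in a..b, p x :=
    intervalIntegral_pos_of_pos (hp.intervalIntegrable _ _) hp0 hab
  set P := ∫ x in a..b, p x
  set m := (∫ x in a..b, f x * p x) / P with hm
  have hdev : ∀ x ∈ Set.Icc a b, |f x - m| ≤ K := by
    intro x hx
    have h1 : (f x - m) * P = ∫ y in a..b, (f x - f y) * p y := by
      have : ∫ y in a..b, (f x - f y) * p y = ∫ y in a..b, (f x * p y - f y * p y) :=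
        integral_congr fun y _ => sub_mul _ _ _
      rw [this, intervalIntegral.integral_sub
        (Continuous.intervalIntegrable (by fun_prop) _ _)
        (Continuous.intervalIntegrable (by fun_prop) _ _),
        intervalIntegral.integral_const_mul, hm, sub_mul,
        div_mul_cancel₀ _ hP.ne']
    have h2 : |(f x - m) * P| ≤ K * P := by
      rw [h1, ← intervalIntegral.integral_const_mul]
      refine (abs_integral_le_integral_abs hab.le).trans (integral_mono_on hab.le
        (((continuous_const.sub hf).mul hp).abs.intervalIntegrable _ _)
        ((continuous_const.mul hp).intervalIntegrable _ _) fun y hy => ?_)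
      rw [abs_mul, abs_of_pos (hp0 y)]
      exact mul_le_mul_of_nonneg_right (hosc x hx y hy) (hp0 y).le
    rw [abs_mul, abs_of_pos hP] at h2
    exact le_of_mul_le_mul_right h2 hP
  have h3 : (∫ x in a..b, f x * p x * j x)
      - (∫ x in a..b, p x * j x) * (∫ x in a..b, f x * p x) / P
      = ∫ x in a..b, (f x - m) * (p x * j x) := by
    have : ∫ x in a..b, (f x - m) * (p x * j x)
        = ∫ x in a..b, (f x * p x * j x - m * (p x * j x)) :=
      integral_congr fun y _ => by ring
    rw [this, intervalIntegral.integral_sub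
      (Continuous.intervalIntegrable (by fun_prop) _ _)
      (Continuous.intervalIntegrable (by fun_prop) _ _),
      intervalIntegral.integral_const_mul, hm]
    ring
  rw [h3, ← intervalIntegral.integral_const_mul]
  refine (abs_integral_le_integral_abs hab.le).trans (integral_mono_on hab.le
    (((hf.sub continuous_const).mul (hp.mul hj)).abs.intervalIntegrable _ _)
    ((continuous_const.mul (hp.mul hj)).intervalIntegrable _ _) fun y hy => ?_)
  have h0 := mul_nonneg (hp0 y).le (hj0 y)
  rw [abs_mul, abs_of_nonneg h0]
  exact mul_le_mul_of_nonneg_right (hdev y hy) h0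

theorem hasDerivAt_fst_of_contDiff {f : ℝ → ℝ → ℝ}
    (hf : ContDiff ℝ (⊤ : ℕ∞) (Function.uncurry f)) (τ θ : ℝ) :
    HasDerivAt (fun s => f s θ) (fderiv ℝ (Function.uncurry f) (τ, θ) (1, 0)) τ :=
  ((hf.differentiable (by simp)) (τ, θ)).hasFDerivAt.comp_hasDerivAt (f := fun s => (s, θ)) τ
    ((hasDerivAt_id τ).prodMk (hasDerivAt_const τ θ))

theorem hasDerivAt_snd_of_contDiff {f : ℝ → ℝ → ℝ}
    (hf : ContDiff ℝ (⊤ : ℕ∞) (Function.uncurry f)) (τ θ : ℝ) :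
    HasDerivAt (fun x => f τ x) (fderiv ℝ (Function.uncurry f) (τ, θ) (0, 1)) θ :=
  ((hf.differentiable (by simp)) (τ, θ)).hasFDerivAt.comp_hasDerivAt (f := fun x => (τ, x)) θ
    ((hasDerivAt_const θ τ).prodMk (hasDerivAt_id θ))

theorem continuous_deriv_fst_of_contDiff {f : ℝ → ℝ → ℝ}
    (hf : ContDiff ℝ (⊤ : ℕ∞) (Function.uncurry f)) :
    Continuous (fun q : ℝ × ℝ => deriv (fun s => f s q.2) q.1) := by
  have h : (fun q : ℝ × ℝ => deriv (fun s => f s q.2) q.1)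
      = fun q => fderiv ℝ (Function.uncurry f) q (1, 0) :=
    funext fun q => (hasDerivAt_fst_of_contDiff hf q.1 q.2).deriv
  rw [h]
  exact (hf.continuous_fderiv (by simp)).clm_apply continuous_const

theorem continuous_deriv_snd_of_contDiff {f : ℝ → ℝ → ℝ}
    (hf : ContDiff ℝ (⊤ : ℕ∞) (Function.uncurry f)) :
    Continuous (fun q : ℝ × ℝ => deriv (fun x => f q.1 x) q.2) := by
  have h : (fun q : ℝ × ℝ => deriv (fun x => f q.1 x) q.2)
      = fun q => fderiv ℝ (Function.uncurry f) q (0, 1) :=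
    funext fun q => (hasDerivAt_snd_of_contDiff hf q.1 q.2).deriv
  rw [h]
  exact (hf.continuous_fderiv (by simp)).clm_apply continuous_const

namespace T2Flow

variable (F : T2Flow)

theorem J_nonneg (τ θ : ℝ) : 0 ≤ F.J τ θ := by
  unfold J
  positivity

theorem continuous_J : Continuous (Function.uncurry F.J) := by
  have hV : Continuous fun q : ℝ × ℝ => F.V q.1 q.2 := F.smooth_V.continuous
  have hρ : Continuous fun q : ℝ × ℝ => F.ρ q.1 q.2 := F.smooth_ρ.continuous
  have hVτ : Continuous fun q : ℝ × ℝ => F.Vτ q.1 q.2 :=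
    continuous_deriv_fst_of_contDiff F.smooth_V
  have hVθ : Continuous fun q : ℝ × ℝ => F.Vθ q.1 q.2 :=
    continuous_deriv_snd_of_contDiff F.smooth_V
  have hQτ : Continuous fun q : ℝ × ℝ => F.Qτ q.1 q.2 :=
    continuous_deriv_fst_of_contDiff F.smooth_Q
  have hQθ : Continuous fun q : ℝ × ℝ => F.Qθ q.1 q.2 :=
    continuous_deriv_snd_of_contDiff F.smooth_Q
  change Continuous fun q : ℝ × ℝ => F.J q.1 q.2
  unfold J
  fun_prop

variable {F}

/-- The momentum constraint bounds `l_θ` by the energy density. -/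
theorem IsEinsteinFlow.abs_lθ_le (hF : F.IsEinsteinFlow) (τ θ : ℝ) :
    |F.lθ τ θ| ≤ exp (F.ρ τ θ - τ) * F.J τ θ := by
  set k := exp (τ - F.ρ τ θ) with hk
  have hk0 : 0 < k := exp_pos _
  have hk2 : exp (2 * (τ - F.ρ τ θ)) = k ^ 2 := by rw [hk, ← exp_nat_mul]; norm_num
  have hk1 : exp (F.ρ τ θ - τ) = k⁻¹ := by rw [hk, ← exp_neg]; congr 1; ring
  have hM : 0 < exp (2 * (F.V τ θ - τ)) := exp_pos _
  rw [hF.2.2.2.2 τ θ, hk1, inv_mul_eq_div, le_div_iff₀ hk0, J, hk2]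
  set M := exp (2 * (F.V τ θ - τ))
  rw [← abs_of_pos hk0, ← abs_mul, abs_of_pos hk0, abs_le]
  constructor
  · linarith [sq_nonneg (F.Vτ τ θ + k * F.Vθ τ θ),
      mul_nonneg hM.le (sq_nonneg (F.Qτ τ θ + k * F.Qθ τ θ))]
  · linarith [sq_nonneg (F.Vτ τ θ - k * F.Vθ τ θ),
      mul_nonneg hM.le (sq_nonneg (F.Qτ τ θ - k * F.Qθ τ θ))]

/-- The derivative of the twist potential. -/
theorem IsEinsteinFlow.hasDerivAt_Y (hF : F.IsEinsteinFlow) (τ : ℝ) :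
    HasDerivAt F.Y (∫ θ in (0:ℝ)..1, exp (F.l τ θ + F.ρ τ θ + 2*τ) * F.J τ θ) τ := by
  have hρ : Continuous fun q : ℝ × ℝ => F.ρ q.1 q.2 := F.smooth_ρ.continuous
  have hl : Continuous fun q : ℝ × ℝ => F.l q.1 q.2 := F.smooth_l.continuous
  have hw : Continuous fun q : ℝ × ℝ => exp (F.l q.1 q.2 + F.ρ q.1 q.2 + 2 * q.1) := by
    fun_prop
  refine hasDerivAt_intervalIntegral_of_continuous
    (f := fun τ θ => exp (F.l τ θ + F.ρ τ θ + 2*τ)) hw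
    (f' := fun τ θ => exp (F.l τ θ + F.ρ τ θ + 2*τ) * F.J τ θ)
    (hw.mul F.continuous_J) (fun s θ => ?_) τ
  have h1 : HasDerivAt (fun s => F.l s θ) (F.lτ s θ) s :=
    (hasDerivAt_fst_of_contDiff F.smooth_l s θ).differentiableAt.hasDerivAt
  have h2 : HasDerivAt (fun s => F.ρ s θ) (F.ρτ s θ) s :=
    (hasDerivAt_fst_of_contDiff F.smooth_ρ s θ).differentiableAt.hasDerivAt
  have h3 : HasDerivAt (fun s : ℝ => 2 * s) 2 s := by
    simpa using (hasDerivAt_id s).const_mul 2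
  rw [← hF.2.2.1 s θ]
  exact ((h1.add h2).add h3).exp

theorem IsEinsteinFlow.abs_exp_l_sub_le (hF : F.IsEinsteinFlow) (τ : ℝ) {x y : ℝ}
    (hx : x ∈ Set.Icc (0:ℝ) 1) (hy : y ∈ Set.Icc (0:ℝ) 1) :
    |exp (F.l τ x + 2*τ) - exp (F.l τ y + 2*τ)| ≤ exp (-τ) * deriv F.Y τ := by
  have hρ : Continuous (F.ρ τ) := continuous_section F.smooth_ρ.continuous τ
  have hl : Continuous (F.l τ) := continuous_section F.smooth_l.continuous τ
  have hJ : Continuous (F.J τ) := continuous_section F.continuous_J τ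
  have hlθ : Continuous (F.lθ τ) :=
    (continuous_deriv_snd_of_contDiff F.smooth_l).comp (Continuous.prodMk_right τ)
  rw [(hF.hasDerivAt_Y τ).deriv, ← intervalIntegral.integral_const_mul]
  refine abs_sub_le_integral_of_abs_deriv_le (f := fun θ => exp (F.l τ θ + 2*τ))
    (f' := fun θ => exp (F.l τ θ + 2*τ) * F.lθ τ θ) (fun θ => ?_) (by fun_prop)
    (by fun_prop) (fun θ => ?_) hx hy
  · have h1 : HasDerivAt (fun x => F.l τ x) (F.lθ τ θ) θ :=
      (hasDerivAt_snd_of_contDiff F.smooth_l τ θ).differentiableAt.hasDerivAt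
    exact (h1.add_const (2 * τ)).exp
  · rw [abs_mul, abs_of_pos (exp_pos _)]
    refine (mul_le_mul_of_nonneg_left (hF.abs_lθ_le τ θ) (exp_pos _).le).trans_eq ?_
    rw [← mul_assoc, ← mul_assoc, ← exp_add, ← exp_add]
    ring_nf

theorem exp_two_mul_E (F : T2Flow) (τ : ℝ) :
    exp (2*τ) * F.E τ = ∫ θ in (0:ℝ)..1, exp (F.ρ τ θ) * F.J τ θ := by
  rw [E, ← intervalIntegral.integral_const_mul]
  refine integral_congr fun θ _ => ?_
  change exp (2*τ) * (exp (F.ρ τ θ - 2*τ) * F.J τ θ) = _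
  rw [← mul_assoc, ← exp_add]
  ring_nf

theorem IsEinsteinFlow.abs_Ω_le (hF : F.IsEinsteinFlow) (τ : ℝ) :
    |F.Ω τ| ≤ exp τ * F.E τ * deriv F.Y τ := by
  have hρ : Continuous (F.ρ τ) := continuous_section F.smooth_ρ.continuous τ
  have hl : Continuous (F.l τ) := continuous_section F.smooth_l.continuous τ
  have key := abs_weighted_covariance_le (p := fun θ => exp (F.ρ τ θ))
    (f := fun θ => exp (F.l τ θ + 2*τ)) (j := F.J τ) zero_lt_one
    (by fun_prop) (by fun_prop) (continuous_section F.continuous_J τ)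
    (fun θ => exp_pos _) (F.J_nonneg τ) fun x hx y hy => hF.abs_exp_l_sub_le τ hx hy
  have hw : ∀ θ, exp (F.l τ θ + 2*τ) * exp (F.ρ τ θ) = exp (F.l τ θ + F.ρ τ θ + 2*τ) :=
    fun θ => by rw [← exp_add]; ring_nf
  simp only [hw, ← exp_two_mul_E] at key
  refine key.trans_eq ?_
  have h : exp τ = exp (-τ) * exp (2*τ) := by rw [← exp_add]; ring_nf
  rw [h]
  ring

end T2Flow

/-- For `B₀` solutions, wherever `H ≠ 0`,
`|e^{−3τ} H^{−1/2} Ω| ≲ e^{−2τ} |H|^{−1/2} E Y_τ`. -/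
theorem omega_bound :
    ∃ C : ℝ, 0 < C ∧ ∀ (F : T2Flow), F.IsEinsteinFlow → (∀ τ : ℝ, F.B τ = 0) →
      ∀ τ : ℝ, F.H τ ≠ 0 →
        |Real.exp (-3*τ) * (Real.sqrt (F.H τ))⁻¹ * F.Ω τ|
          ≤ C * (Real.exp (-2*τ) * (Real.sqrt |F.H τ|)⁻¹ * F.E τ * deriv F.Y τ) := by
  refine ⟨1, one_pos, fun F hF _ τ _ => ?_⟩
  have hle := hF.abs_Ω_le τ
  have hsqrt : (Real.sqrt (F.H τ))⁻¹ ≤ (Real.sqrt |F.H τ|)⁻¹ := by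
    rcases le_or_gt 0 (F.H τ) with h | h
    · rw [abs_of_nonneg h]
    · rw [Real.sqrt_eq_zero_of_nonpos h.le, inv_zero]
      positivity
  rw [abs_mul, abs_mul, abs_of_pos (exp_pos _), abs_of_nonneg (by positivity), one_mul]
  calc exp (-3*τ) * (Real.sqrt (F.H τ))⁻¹ * |F.Ω τ|
      ≤ exp (-3*τ) * (Real.sqrt |F.H τ|)⁻¹ * (exp τ * F.E τ * deriv F.Y τ) := by gcongr
    _ = exp (-2*τ) * (Real.sqrt |F.H τ|)⁻¹ * F.E τ * deriv F.Y τ := by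
      have h : exp (-2*τ) = exp (-3*τ) * exp τ := by rw [← exp_add]; ring_nf
      rw [h]
      ring
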